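/- Let V(r₁,r₂,r₃) denote the minimal Coulomb energy of three unit point charges on concentric spheres of radii r₁,r₂,r₃, let S be the base-3 digit-shift map, and define F(ε) = 3 ∫₀^{1/3} V(1+εx, 1+εS(x), 1+εS(S(x))) dx for ε > 0. Then, as ε → 0⁺, F(ε) = √3 · (1 − ε/2 + (31/120)ε²) + O(ε³). -/

import Mathlib

/-- `V(r₁,r₂,r₃)`: the minimal Coulomb energy of three unit point charges
confined to concentric spheres of radii `r₁, r₂, r₃` in `ℝ³`, i.e. the
infimum of `Σ_{i<j} 1/‖x_i − x_j‖` over `x_i ∈ ℝ³` with `‖x_i‖ = r_i`. -/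
noncomputable def V3 (r₁ r₂ r₃ : ℝ) : ℝ :=
  sInf {e : ℝ | ∃ x₁ x₂ x₃ : EuclideanSpace ℝ (Fin 3),
    ‖x₁‖ = r₁ ∧ ‖x₂‖ = r₂ ∧ ‖x₃‖ = r₃ ∧
    e = 1 / ‖x₁ - x₂‖ + 1 / ‖x₁ - x₃‖ + 1 / ‖x₂ - x₃‖}

/-- The `ℓ`-th digit (for `ℓ ≥ 1`) of the canonical base-`N` expansion of
`x ∈ [0,1)`: `n_ℓ = ⌊x·N^ℓ⌋ mod N`.  The resulting digit sequence is the
unique one that is not eventually equal to `N−1`. -/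
noncomputable def digit (N : ℕ) (x : ℝ) (ℓ : ℕ) : ℕ :=
  (⌊x * (N : ℝ) ^ ℓ⌋).toNat % N

/-- The digit-shift map `S(x) = Σ_{ℓ≥1} ℘(n_ℓ)/N^ℓ`, where `℘` raises each
digit by one modulo `N`. -/
noncomputable def shiftMap (N : ℕ) (x : ℝ) : ℝ :=
  ∑' ℓ : ℕ, (((digit N x (ℓ + 1) + 1) % N : ℕ) : ℝ) / (N : ℝ) ^ (ℓ + 1)

/-- The fractal (FRC) interaction energy `F(ε) = a·V_ee^FRC(a,ε)` for the
thin spherical-shell density with `N = 3` electrons. -/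
noncomputable def Ffrc (ε : ℝ) : ℝ :=
  3 * ∫ x in (0:ℝ)..(1/3),
    V3 (1 + ε * x) (1 + ε * shiftMap 3 x) (1 + ε * shiftMap 3 (shiftMap 3 x))

open MeasureTheory

/-! ### The digit shift map -/

lemma frc_term_nonneg (x : ℝ) (l : ℕ) :
    0 ≤ (((digit 3 x (l + 1) + 1) % 3 : ℕ) : ℝ) / ((3 : ℕ) : ℝ) ^ (l + 1) := by positivity

lemma frc_term_le (x : ℝ) (l : ℕ) :
    (((digit 3 x (l + 1) + 1) % 3 : ℕ) : ℝ) / ((3 : ℕ) : ℝ) ^ (l + 1)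
      ≤ (2 / 3) * (1 / 3 : ℝ) ^ l := by
  have h : (digit 3 x (l + 1) + 1) % 3 ≤ 2 := by omega
  have h' : (((digit 3 x (l + 1) + 1) % 3 : ℕ) : ℝ) ≤ 2 := by exact_mod_cast h
  calc _ ≤ 2 / ((3 : ℕ) : ℝ) ^ (l + 1) := by gcongr
    _ = _ := by
      push_cast
      rw [pow_succ, one_div, inv_pow]
      field_simp

lemma frc_geom : HasSum (fun l : ℕ => (2 / 3) * (1 / 3 : ℝ) ^ l) 1 := by
  have := (hasSum_geometric_of_lt_one (r := (1 / 3 : ℝ)) (by norm_num) (by norm_num)).mul_left (2/3)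
  have e : (2 / 3 : ℝ) * (1 - 1 / 3)⁻¹ = 1 := by norm_num
  rw [e] at this
  exact this

lemma frc_summable (x : ℝ) :
    Summable fun l : ℕ => (((digit 3 x (l + 1) + 1) % 3 : ℕ) : ℝ) / ((3 : ℕ) : ℝ) ^ (l + 1) :=
  Summable.of_nonneg_of_le (frc_term_nonneg x) (frc_term_le x) frc_geom.summable

lemma shift_nonneg (x : ℝ) : 0 ≤ shiftMap 3 x := tsum_nonneg (frc_term_nonneg x)

lemma shift_le_one (x : ℝ) : shiftMap 3 x ≤ 1 := by
  rw [← frc_geom.tsum_eq]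
  exact (frc_summable x).tsum_le_tsum (frc_term_le x) frc_geom.summable

lemma shift_measurable : Measurable (shiftMap 3) := by
  unfold shiftMap
  apply Measurable.tsum
  intro l
  apply Measurable.div_const
  have h1 : Measurable fun x : ℝ => ⌊x * ((3 : ℕ) : ℝ) ^ (l + 1)⌋ :=
    Int.measurable_floor.comp (measurable_id.mul_const _)
  exact (measurable_from_top (f := fun z : ℤ => (((z.toNat % 3 + 1) % 3 : ℕ) : ℝ))).comp h1

lemma digit_zero (n : ℕ) (hn : n < 3) (y : ℝ) (h0 : 0 ≤ y) (h1 : y < 1) :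
    digit 3 ((n + y) / 3) 1 = n := by
  unfold digit
  have : ⌊((n : ℝ) + y) / 3 * ((3 : ℕ) : ℝ) ^ 1⌋ = (n : ℤ) := by
    rw [Int.floor_eq_iff]
    push_cast
    constructor <;> linarith
  rw [this]
  simp
  omega

lemma digit_succ (n : ℕ) (y : ℝ) (h0 : 0 ≤ y) (l : ℕ) :
    digit 3 ((n + y) / 3) (l + 1 + 1) = digit 3 y (l + 1) := by
  unfold digit
  have h2 : ((n : ℝ) + y) / 3 * ((3 : ℕ) : ℝ) ^ (l + 1 + 1)
      = y * ((3 : ℕ) : ℝ) ^ (l + 1) + ((n * 3 ^ (l + 1) : ℕ) : ℝ) := by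
    push_cast
    rw [pow_succ _ (l + 1)]
    ring
  have h3 : 0 ≤ ⌊y * ((3 : ℕ) : ℝ) ^ (l + 1)⌋ := Int.floor_nonneg.2 (by positivity)
  rw [h2, Int.floor_add_natCast]
  obtain ⟨m, hm⟩ := Int.eq_ofNat_of_zero_le h3
  rw [hm]
  have : ((m : ℤ) + ((n * 3 ^ (l + 1) : ℕ) : ℤ)).toNat = m + n * 3 ^ (l + 1) := by
    rw [← Nat.cast_add, Int.toNat_natCast]
  rw [this, Int.toNat_natCast, pow_succ, ← mul_assoc, Nat.add_mul_mod_self_right]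

lemma shift_rec (n : ℕ) (hn : n < 3) (y : ℝ) (h0 : 0 ≤ y) (h1 : y < 1) :
    shiftMap 3 ((n + y) / 3) = (((n + 1) % 3 : ℕ) + shiftMap 3 y) / 3 := by
  conv_lhs => unfold shiftMap
  rw [(frc_summable _).tsum_eq_zero_add]
  have : ∀ l : ℕ, (((digit 3 (((n : ℝ) + y) / 3) (l + 1 + 1) + 1) % 3 : ℕ) : ℝ)
      / ((3 : ℕ) : ℝ) ^ (l + 1 + 1)
      = ((((digit 3 y (l + 1) + 1) % 3 : ℕ) : ℝ) / ((3 : ℕ) : ℝ) ^ (l + 1)) / 3 := by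
    intro l
    rw [digit_succ n y h0 l, pow_succ _ (l + 1), div_div]
    push_cast
    rfl
  simp only [this, zero_add, digit_zero n hn y h0 h1]
  rw [tsum_div_const]
  unfold shiftMap
  push_cast
  ring

lemma exists_digit (y : ℝ) (h0 : 0 ≤ y) (h1 : y < 1) :
    ∃ n : ℕ, n < 3 ∧ ∃ z : ℝ, 0 ≤ z ∧ z < 1 ∧ y = (n + z) / 3 := by
  refine ⟨⌊3 * y⌋₊, ?_, 3 * y - ⌊3 * y⌋₊, ?_, ?_, by ring⟩
  · rw [Nat.floor_lt (by positivity)]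
    push_cast; linarith
  · linarith [Nat.floor_le (show 0 ≤ 3 * y by positivity)]
  · linarith [Nat.lt_floor_add_one (3 * y)]

lemma shift_eq_one_aux (k : ℕ) : ∀ y : ℝ, 0 ≤ y → y < 1 → shiftMap 3 y = 1 →
    |y - 1/2| ≤ (1/3 : ℝ) ^ k := by
  induction k with
  | zero => intro y h0 h1 _; rw [pow_zero, abs_le]; constructor <;> linarith
  | succ k ih =>
    intro y h0 h1 h
    obtain ⟨n, hn, z, hz0, hz1, rfl⟩ := exists_digit y h0 h1
    rw [shift_rec n hn z hz0 hz1] at h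
    have hz := shift_le_one z
    have hn1 : n = 1 := by
      interval_cases n
      · norm_num at h; linarith
      · rfl
      · norm_num at h; linarith
    subst hn1
    norm_num at h
    have := ih z hz0 hz1 (by linarith)
    rw [pow_succ, abs_le] at *
    push_cast
    constructor <;> linarith [this.1, this.2]

lemma shift_lt_one (y : ℝ) (h0 : 0 ≤ y) (h1 : y < 1) (h : y ≠ 1/2) : shiftMap 3 y < 1 := by
  refine lt_of_le_of_ne (shift_le_one y) fun h' => h ?_
  have h2 : |y - 1/2| ≤ 0 :=
    ge_of_tendsto' (tendsto_pow_atTop_nhds_zero_of_lt_one (by norm_num) (by norm_num))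
      (fun k => shift_eq_one_aux k y h0 h1 h')
  have := abs_nonpos_iff.1 h2
  linarith

lemma shift_shift_rec (n : ℕ) (hn : n < 3) (y : ℝ) (h0 : 0 ≤ y) (h1 : y < 1) (h : y ≠ 1/2) :
    shiftMap 3 (shiftMap 3 ((n + y) / 3))
      = (((n + 2) % 3 : ℕ) + shiftMap 3 (shiftMap 3 y)) / 3 := by
  rw [shift_rec n hn y h0 h1, shift_rec _ (by omega) _ (shift_nonneg y) (shift_lt_one y h0 h1 h)]
  congr 3
  omega

/-! ### Moments -/

/-- bounded measurable functions are interval integrable -/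
lemma frc_ii (f : ℝ → ℝ) (hf : Measurable f) (K : ℝ) (a b : ℝ)
    (hK : ∀ x ∈ Set.uIoc a b, |f x| ≤ K) : IntervalIntegrable f volume a b := by
  rw [intervalIntegrable_iff]
  refine Measure.integrableOn_of_bounded (M := K) ?_ hf.aestronglyMeasurable ?_
  · simp
  · exact (ae_restrict_iff' measurableSet_uIoc).2 (Filter.Eventually.of_forall hK)

lemma frc_ae : ∀ᵐ y : ℝ, y ≠ 1/2 ∧ y ≠ 1 := by
  have h1 : ∀ᵐ y : ℝ, y ≠ 1/2 := by
    rw [ae_iff]; simp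
  have h2 : ∀ᵐ y : ℝ, y ≠ 1 := by
    rw [ae_iff]; simp
  filter_upwards [h1, h2] with y a b using ⟨a, b⟩

/-- the piece of an integral with given first digit -/
lemma frc_piece (n : ℕ) (hn : n < 3) (G : ℝ → ℝ → ℝ → ℝ) :
    ∫ x in ((n : ℝ) / 3)..((n + 1 : ℝ) / 3), G x (shiftMap 3 x) (shiftMap 3 (shiftMap 3 x))
    = (1/3) * ∫ y in (0:ℝ)..1, G ((n + y) / 3) ((((n + 1) % 3 : ℕ) + shiftMap 3 y) / 3)
      ((((n + 2) % 3 : ℕ) + shiftMap 3 (shiftMap 3 y)) / 3) := by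
  have h := intervalIntegral.integral_comp_add_div (a := 0) (b := 1) (c := 3)
    (fun x => G x (shiftMap 3 x) (shiftMap 3 (shiftMap 3 x))) (by norm_num) ((n : ℝ) / 3)
  have h2 : (∫ y in (0:ℝ)..1, G ((n + y) / 3) ((((n + 1) % 3 : ℕ) + shiftMap 3 y) / 3)
      ((((n + 2) % 3 : ℕ) + shiftMap 3 (shiftMap 3 y)) / 3))
      = ∫ y in (0:ℝ)..1, (fun x => G x (shiftMap 3 x) (shiftMap 3 (shiftMap 3 x)))
        ((n : ℝ) / 3 + y / 3) := by
    apply intervalIntegral.integral_congr_ae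
    filter_upwards [frc_ae] with y hy hy'
    rw [Set.uIoc_of_le zero_le_one] at hy'
    have hy1 : y < 1 := lt_of_le_of_ne hy'.2 hy.2
    have e : (n : ℝ) / 3 + y / 3 = (n + y) / 3 := by ring
    simp only [e]
    rw [shift_shift_rec n hn y hy'.1.le hy1 hy.1, shift_rec n hn y hy'.1.le hy1]
  rw [h2, h]
  simp only [smul_eq_mul, zero_div, add_zero]
  rw [← add_div]
  ring

lemma frc_split (f : ℝ → ℝ) (hf : ∀ a b, IntervalIntegrable f volume a b) :
    ∫ x in (0:ℝ)..1, f x = (∫ x in (((0:ℕ):ℝ)/3)..((((0:ℕ):ℝ) + 1)/3), f x)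
      + (∫ x in (((1:ℕ):ℝ)/3)..((((1:ℕ):ℝ) + 1)/3), f x)
      + ∫ x in (((2:ℕ):ℝ)/3)..((((2:ℕ):ℝ) + 1)/3), f x := by
  norm_num
  rw [intervalIntegral.integral_add_adjacent_intervals (hf _ _) (hf _ _),
    intervalIntegral.integral_add_adjacent_intervals (hf _ _) (hf _ _)]

lemma shift_ii (a b : ℝ) : IntervalIntegrable (fun x => shiftMap 3 x) volume a b :=
  frc_ii _ shift_measurable 1 a b fun x _ => by
    rw [abs_of_nonneg (shift_nonneg x)]; exact shift_le_one x

lemma shift2_ii (a b : ℝ) : IntervalIntegrable (fun x => shiftMap 3 (shiftMap 3 x)) volume a b :=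
  frc_ii _ (shift_measurable.comp shift_measurable) 1 a b fun x _ => by
    show |shiftMap 3 (shiftMap 3 x)| ≤ 1
    rw [abs_of_nonneg (shift_nonneg _)]; exact shift_le_one _

/-- sum -/
noncomputable def sA (x : ℝ) : ℝ := x + shiftMap 3 x + shiftMap 3 (shiftMap 3 x)
/-- sum of squares -/
noncomputable def sP (x : ℝ) : ℝ :=
  x ^ 2 + shiftMap 3 x ^ 2 + shiftMap 3 (shiftMap 3 x) ^ 2

lemma sA_meas : Measurable sA :=
  (measurable_id.add shift_measurable).add (shift_measurable.comp shift_measurable)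
lemma sP_meas : Measurable sP :=
  ((measurable_id.pow_const 2).add (shift_measurable.pow_const 2)).add
    ((shift_measurable.comp shift_measurable).pow_const 2)

lemma sA_ii (a b : ℝ) : IntervalIntegrable sA volume a b :=
  ((continuous_id.intervalIntegrable a b).add (shift_ii a b)).add (shift2_ii a b)

lemma shift_sq_le (x : ℝ) : shiftMap 3 x ^ 2 ≤ 1 := by
  nlinarith [shift_nonneg x, shift_le_one x]

lemma sP_ii (a b : ℝ) : IntervalIntegrable sP volume a b := by
  refine (((continuous_pow 2).intervalIntegrable a b).add (frc_ii _ ?_ 1 a b fun x _ => ?_)).add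
    (frc_ii _ ?_ 1 a b fun x _ => ?_)
  · exact shift_measurable.pow_const 2
  · rw [abs_of_nonneg (by positivity)]; exact shift_sq_le x
  · exact (shift_measurable.comp shift_measurable).pow_const 2
  · rw [abs_of_nonneg (by positivity)]; exact shift_sq_le _

lemma sA2_ii (a b : ℝ) : IntervalIntegrable (fun x => sA x ^ 2) volume a b := by
  refine frc_ii _ (sA_meas.pow_const 2) ((max |a| |b| + 2) ^ 2) a b fun x hx => ?_
  rw [abs_of_nonneg (by positivity), ← sq_abs]
  gcongr
  have h1 : |x| ≤ max |a| |b| := by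
    rcases Set.mem_uIoc.1 hx with h | h
    · exact abs_le_max_abs_abs h.1.le h.2
    · rw [max_comm]; exact abs_le_max_abs_abs h.1.le h.2
  unfold sA
  refine (abs_add_three _ _ _).trans ?_
  rw [abs_of_nonneg (shift_nonneg _), abs_of_nonneg (shift_nonneg _)]
  linarith [shift_le_one x, shift_le_one (shiftMap 3 x)]

lemma int_id : ∫ x in (0:ℝ)..1, x = 1/2 := by
  rw [integral_id]; norm_num

lemma int_const_mul_add (f : ℝ → ℝ) (hf : IntervalIntegrable f volume 0 1) (c d : ℝ) :
    ∫ x in (0:ℝ)..1, (c + f x) / d = (c + ∫ x in (0:ℝ)..1, f x) / d := by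
  rw [intervalIntegral.integral_div, intervalIntegral.integral_add (by simp) hf]
  simp

lemma int_shift : ∫ x in (0:ℝ)..1, shiftMap 3 x = 1/2 := by
  have h := frc_split _ shift_ii
  rw [frc_piece 0 (by norm_num) (fun _ b _ => b), frc_piece 1 (by norm_num) (fun _ b _ => b),
    frc_piece 2 (by norm_num) (fun _ b _ => b)] at h
  simp only [int_const_mul_add _ (shift_ii 0 1)] at h
  norm_num at h
  linarith

lemma int_shift2 : ∫ x in (0:ℝ)..1, shiftMap 3 (shiftMap 3 x) = 1/2 := by
  have h := frc_split _ shift2_ii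
  rw [frc_piece 0 (by norm_num) (fun _ _ b => b), frc_piece 1 (by norm_num) (fun _ _ b => b),
    frc_piece 2 (by norm_num) (fun _ _ b => b)] at h
  simp only [int_const_mul_add _ (shift2_ii 0 1)] at h
  norm_num at h
  linarith

lemma int_sA : ∫ x in (0:ℝ)..1, sA x = 3/2 := by
  have i1 : IntervalIntegrable (fun x : ℝ => x) volume 0 1 := continuous_id.intervalIntegrable 0 1
  unfold sA
  rw [intervalIntegral.integral_add (i1.add (shift_ii 0 1))
    (shift2_ii 0 1), intervalIntegral.integral_add i1
    (shift_ii 0 1), int_shift, int_shift2, int_id]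
  norm_num

lemma piece_sA (n : ℕ) (hn : n < 3) :
    ∫ x in ((n : ℝ) / 3)..((n + 1 : ℝ) / 3), sA x = 1/2 := by
  have h := frc_piece n hn (fun a b c => a + b + c)
  have e : ∀ y, ((n + y) / 3 + (((n + 1) % 3 : ℕ) + shiftMap 3 y) / 3 +
      (((n + 2) % 3 : ℕ) + shiftMap 3 (shiftMap 3 y)) / 3) = (3 + sA y) / 3 := by
    intro y; unfold sA; interval_cases n <;> norm_num <;> ring
  simp only [e] at h
  rw [int_const_mul_add _ (sA_ii 0 1), int_sA] at h
  refine Eq.trans h ?_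
  norm_num

lemma piece_sA2_aux (n : ℕ) (hn : n < 3) :
    ∫ x in ((n : ℝ) / 3)..((n + 1 : ℝ) / 3), sA x ^ 2
      = (1/3) * (2 + (∫ x in (0:ℝ)..1, sA x ^ 2) / 9) := by
  have h := frc_piece n hn (fun a b c => (a + b + c) ^ 2)
  have e : ∀ y, ((n + y) / 3 + (((n + 1) % 3 : ℕ) + shiftMap 3 y) / 3 +
      (((n + 2) % 3 : ℕ) + shiftMap 3 (shiftMap 3 y)) / 3) ^ 2
      = (9 + (6 * sA y + sA y ^ 2)) / 9 := by
    intro y; unfold sA; interval_cases n <;> norm_num <;> ring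
  simp only [e] at h
  rw [int_const_mul_add _ (((sA_ii 0 1).const_mul 6).add (sA2_ii 0 1)),
    intervalIntegral.integral_add ((sA_ii 0 1).const_mul 6) (sA2_ii 0 1),
    intervalIntegral.integral_const_mul, int_sA] at h
  refine Eq.trans h ?_
  ring

lemma int_sA2 : ∫ x in (0:ℝ)..1, sA x ^ 2 = 9/4 := by
  have h := frc_split _ sA2_ii
  rw [piece_sA2_aux 0 (by norm_num), piece_sA2_aux 1 (by norm_num),
    piece_sA2_aux 2 (by norm_num)] at h
  linarith

lemma piece_sP_aux (n : ℕ) (hn : n < 3) :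
    ∫ x in ((n : ℝ) / 3)..((n + 1 : ℝ) / 3), sP x
      = (1/3) * ((8 + ∫ x in (0:ℝ)..1, sP x) / 9) := by
  have h := frc_piece n hn (fun a b c => a ^ 2 + b ^ 2 + c ^ 2)
  have e : ∀ y, (((n + y) / 3) ^ 2 + ((((n + 1) % 3 : ℕ) + shiftMap 3 y) / 3) ^ 2 +
      ((((n + 2) % 3 : ℕ) + shiftMap 3 (shiftMap 3 y)) / 3) ^ 2)
      = (5 + ((((2 * n : ℕ) : ℝ) * y + ((2 * ((n + 1) % 3) : ℕ) : ℝ) * shiftMap 3 y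
        + ((2 * ((n + 2) % 3) : ℕ) : ℝ) * shiftMap 3 (shiftMap 3 y)) + sP y)) / 9 := by
    intro y; unfold sP; interval_cases n <;> norm_num <;> ring
  simp only [e] at h
  have i1 := (continuous_id.intervalIntegrable (μ := volume) (0:ℝ) 1).const_mul ((2 * n : ℕ) : ℝ)
  have i2 := (shift_ii 0 1).const_mul ((2 * ((n + 1) % 3) : ℕ) : ℝ)
  have i3 := (shift2_ii 0 1).const_mul ((2 * ((n + 2) % 3) : ℕ) : ℝ)
  simp only [id] at i1
  rw [int_const_mul_add _ (((i1.add i2).add i3).add (sP_ii 0 1)),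
    intervalIntegral.integral_add ((i1.add i2).add i3) (sP_ii 0 1),
    intervalIntegral.integral_add (i1.add i2) i3,
    intervalIntegral.integral_add i1 i2,
    intervalIntegral.integral_const_mul, intervalIntegral.integral_const_mul,
    intervalIntegral.integral_const_mul, int_id, int_shift, int_shift2] at h
  refine Eq.trans h ?_
  interval_cases n <;> norm_num <;> ring

lemma int_sP : ∫ x in (0:ℝ)..1, sP x = 1 := by
  have h := frc_split _ sP_ii
  rw [piece_sP_aux 0 (by norm_num), piece_sP_aux 1 (by norm_num),
    piece_sP_aux 2 (by norm_num)] at h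
  linarith

lemma third_sA : ∫ x in (0:ℝ)..(1/3), sA x = 1/2 := by
  have := piece_sA 0 (by norm_num)
  simpa using this

lemma third_sA2 : ∫ x in (0:ℝ)..(1/3), sA x ^ 2 = 3/4 := by
  have := piece_sA2_aux 0 (by norm_num)
  rw [int_sA2] at this
  norm_num at this ⊢
  exact this

lemma third_sP : ∫ x in (0:ℝ)..(1/3), sP x = 1/3 := by
  have := piece_sP_aux 0 (by norm_num)
  rw [int_sP] at this
  norm_num at this ⊢
  exact this

/-! ### The energy of three charges -/

/-- the dual lower bound for one pair -/
lemma pair_lower (w u v : ℝ) (hu : 0 < u) (hv : 0 < v) (hw : w = u ^ 3 / (2 * v ^ 2)) :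
    3 * u / 2 - w ≤ v := by
  have h : v - (3 * u / 2 - w) = (v - u) ^ 2 * (2 * v + u) / (2 * v ^ 2) := by
    rw [hw]; field_simp; ring
  have : 0 ≤ (v - u) ^ 2 * (2 * v + u) / (2 * v ^ 2) := by positivity
  linarith

lemma inv_dist_lower (d p : ℝ) (hd : 0 < d) (hp : 0 < p) :
    √3 * (p / 2 - d ^ 2 * p ^ 3 / 18) ≤ 1 / d := by
  have h3 : (√3) ^ 2 = 3 := Real.sq_sqrt (by norm_num)
  have hs : 0 < √3 := by positivity
  have := pair_lower (√3 * (d ^ 2 * p ^ 3 / 18)) (√3 * p / 3) (1 / d) (by positivity)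
    (by positivity) (by
      field_simp
      have : √3 ^ 3 = √3 * 3 := by rw [pow_succ, h3]; ring
      nlinarith [this])
  linarith

/-- near-optimal distances -/
lemma inv_dist_upper (d p y : ℝ) (hd : 0 < d) (hp : 0 < p) (hp1 : p ≤ 1)
    (hy : d ^ 2 * p ^ 2 / 3 = 1 + y) (hy1 : |y| ≤ 1/2) :
    1 / d ≤ √3 * (p / 2 - d ^ 2 * p ^ 3 / 18) + 2 * √3 * y ^ 2 := by
  have h3 : (√3) ^ 2 = 3 := Real.sq_sqrt (by norm_num)
  have hs : 0 < √3 := by positivity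
  -- `ρ = u / v = √3 p d / 3`
  obtain ⟨ρ, hρ⟩ : ∃ ρ, ρ = √3 * p * d / 3 := ⟨_, rfl⟩
  have hρ0 : 0 < ρ := by rw [hρ]; positivity
  have hρ2 : ρ ^ 2 = 1 + y := by
    rw [hρ, ← hy, div_pow, mul_pow, mul_pow, h3]; ring
  rw [abs_le] at hy1
  have hl : 1/2 ≤ ρ := by nlinarith
  have hu : ρ ≤ 3/2 := by nlinarith
  have hd' : 1 / d = √3 * p / (3 * ρ) := by
    rw [hρ]; field_simp
  have e1 : p / 2 - d ^ 2 * p ^ 3 / 18 = p * (3 - ρ ^ 2) / 6 := by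
    rw [hρ2, ← hy]; ring
  rw [hd', e1]
  have key : p / (3 * ρ) ≤ p * (3 - ρ ^ 2) / 6 + 2 * y ^ 2 := by
    have h5 : (ρ - 1) ^ 2 * (ρ + 1) ^ 2 = y ^ 2 := by
      have : y = (ρ - 1) * (ρ + 1) := by linarith
      rw [this]; ring
    have h6 : p / (3 * ρ) - p * (3 - ρ ^ 2) / 6 = p * ((ρ - 1) ^ 2 * (ρ + 2)) / (6 * ρ) := by
      field_simp; ring
    have h7 : p * ((ρ - 1) ^ 2 * (ρ + 2)) / (6 * ρ) ≤ 2 * y ^ 2 := by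
      rw [div_le_iff₀ (by positivity), ← h5]
      have h8 : p * ((ρ - 1) ^ 2 * (ρ + 2)) ≤ 1 * ((ρ - 1) ^ 2 * (ρ + 2)) := by gcongr
      have h9 : ρ + 2 ≤ 2 * (ρ + 1) ^ 2 * (6 * ρ) := by nlinarith [mul_pos hρ0 hρ0]
      nlinarith [mul_le_mul_of_nonneg_left h9 (sq_nonneg (ρ - 1))]
    linarith
  have := mul_le_mul_of_nonneg_left key hs.le
  calc √3 * p / (3 * ρ) = √3 * (p / (3 * ρ)) := by ring
    _ ≤ _ := this
    _ = _ := by ring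

/-- the dual function (up to the factor `√3`) -/
noncomputable def dualL (p q s a b c : ℝ) : ℝ :=
  (p * q + p * s + q * s) / 2
    - (p ^ 3 + q ^ 3 + s ^ 3) * (p ^ 3 * a ^ 2 + q ^ 3 * b ^ 2 + s ^ 3 * c ^ 2) / 18

abbrev E3 := EuclideanSpace ℝ (Fin 3)

lemma sum_dist (x y z : E3) (p q s : ℝ) :
    ‖x - y‖ ^ 2 * (p * q) + ‖x - z‖ ^ 2 * (p * s) + ‖y - z‖ ^ 2 * (q * s)
      = (p + q + s) * (p * ‖x‖ ^ 2 + q * ‖y‖ ^ 2 + s * ‖z‖ ^ 2)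
        - ‖p • x + q • y + s • z‖ ^ 2 := by
  simp only [← real_inner_self_eq_norm_sq, inner_sub_left, inner_sub_right, inner_add_left,
    inner_add_right, real_inner_smul_left, real_inner_smul_right]
  rw [real_inner_comm x y, real_inner_comm x z, real_inner_comm y z]
  ring

lemma dist_of_zero (x y z : E3) (p q s : ℝ) (h : p • x + q • y + s • z = 0) :
    ‖x - y‖ ^ 2 * (p * q) = (‖x‖ ^ 2 + ‖y‖ ^ 2) * (p * q)
      + (p ^ 2 * ‖x‖ ^ 2 + q ^ 2 * ‖y‖ ^ 2 - s ^ 2 * ‖z‖ ^ 2) := by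
  have h1 : s • z = -(p • x + q • y) := by
    rw [eq_neg_iff_add_eq_zero, add_comm]; exact h
  have h2 : s ^ 2 * ‖z‖ ^ 2 = ‖p • x + q • y‖ ^ 2 := by
    rw [← norm_neg (p • x + q • y), ← h1, norm_smul, mul_pow, Real.norm_eq_abs, sq_abs]
  rw [h2]
  simp only [← real_inner_self_eq_norm_sq, inner_sub_left, inner_sub_right, inner_add_left,
    inner_add_right, real_inner_smul_left, real_inner_smul_right]
  rw [real_inner_comm x y]
  ring

lemma energy_lower (x y z : E3) (hxy : x ≠ y) (hxz : x ≠ z) (hyz : y ≠ z)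
    (p q s : ℝ) (hp : 0 < p) (hq : 0 < q) (hs : 0 < s) :
    √3 * dualL p q s ‖x‖ ‖y‖ ‖z‖ ≤ 1 / ‖x - y‖ + 1 / ‖x - z‖ + 1 / ‖y - z‖ := by
  have h1 := inv_dist_lower ‖x - y‖ (p * q) (norm_pos_iff.2 (sub_ne_zero.2 hxy)) (by positivity)
  have h2 := inv_dist_lower ‖x - z‖ (p * s) (norm_pos_iff.2 (sub_ne_zero.2 hxz)) (by positivity)
  have h3 := inv_dist_lower ‖y - z‖ (q * s) (norm_pos_iff.2 (sub_ne_zero.2 hyz)) (by positivity)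
  have h4 := sum_dist x y z (p ^ 3) (q ^ 3) (s ^ 3)
  have h5 : dualL p q s ‖x‖ ‖y‖ ‖z‖ ≤ (p * q / 2 - ‖x - y‖ ^ 2 * (p * q) ^ 3 / 18)
      + (p * s / 2 - ‖x - z‖ ^ 2 * (p * s) ^ 3 / 18)
      + (q * s / 2 - ‖y - z‖ ^ 2 * (q * s) ^ 3 / 18) := by
    unfold dualL
    simp only [mul_pow]
    nlinarith [sq_nonneg ‖p ^ 3 • x + q ^ 3 • y + s ^ 3 • z‖]
  have h6 := mul_le_mul_of_nonneg_left h5 (Real.sqrt_nonneg 3)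
  linarith

lemma energy_upper (x y z : E3) (hxy : x ≠ y) (hxz : x ≠ z) (hyz : y ≠ z)
    (p q s : ℝ) (hp : 0 < p) (hq : 0 < q) (hs : 0 < s) (hp1 : p ≤ 1) (hq1 : q ≤ 1) (hs1 : s ≤ 1)
    (h0 : p ^ 3 • x + q ^ 3 • y + s ^ 3 • z = 0) (κ : ℝ) (hκ : κ ≤ 1/2)
    (k1 : |‖x - y‖ ^ 2 * (p * q) ^ 2 / 3 - 1| ≤ κ)
    (k2 : |‖x - z‖ ^ 2 * (p * s) ^ 2 / 3 - 1| ≤ κ)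
    (k3 : |‖y - z‖ ^ 2 * (q * s) ^ 2 / 3 - 1| ≤ κ) :
    1 / ‖x - y‖ + 1 / ‖x - z‖ + 1 / ‖y - z‖ ≤ √3 * dualL p q s ‖x‖ ‖y‖ ‖z‖ + 6 * √3 * κ ^ 2 := by
  have h1 := inv_dist_upper ‖x - y‖ (p * q) _ (norm_pos_iff.2 (sub_ne_zero.2 hxy)) (by positivity)
    (mul_le_one₀ hp1 hq.le hq1) (by ring) (k1.trans hκ)
  have h2 := inv_dist_upper ‖x - z‖ (p * s) _ (norm_pos_iff.2 (sub_ne_zero.2 hxz)) (by positivity)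
    (mul_le_one₀ hp1 hs.le hs1) (by ring) (k2.trans hκ)
  have h3 := inv_dist_upper ‖y - z‖ (q * s) _ (norm_pos_iff.2 (sub_ne_zero.2 hyz)) (by positivity)
    (mul_le_one₀ hq1 hs.le hs1) (by ring) (k3.trans hκ)
  have h4 := sum_dist x y z (p ^ 3) (q ^ 3) (s ^ 3)
  rw [h0] at h4
  have h5 : dualL p q s ‖x‖ ‖y‖ ‖z‖ = (p * q / 2 - ‖x - y‖ ^ 2 * (p * q) ^ 3 / 18)
      + (p * s / 2 - ‖x - z‖ ^ 2 * (p * s) ^ 3 / 18)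
      + (q * s / 2 - ‖y - z‖ ^ 2 * (q * s) ^ 3 / 18) := by
    unfold dualL
    simp only [mul_pow, norm_zero] at h4 ⊢
    linarith
  have sqle : ∀ t, |t| ≤ κ → √3 * t ^ 2 ≤ √3 * κ ^ 2 := by
    intro t ht
    rw [← sq_abs t]
    gcongr
  have a1 := sqle _ k1
  have a2 := sqle _ k2
  have a3 := sqle _ k3
  rw [h5]
  linarith

/-- a configuration with `c₁x₁ + c₂x₂ + c₃x₃ = 0` -/
lemma exists_config (r₁ r₂ r₃ p q s : ℝ) (hr1 : 0 < r₁) (hr2 : 0 < r₂) (hr3 : 0 < r₃)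
    (hp : 0 < p) (hq : 0 < q) (hs : 0 < s)
    (h1 : |p * r₁ - 1| ≤ 1/10) (h2 : |q * r₂ - 1| ≤ 1/10) (h3 : |s * r₃ - 1| ≤ 1/10) :
    ∃ x y z : E3, ‖x‖ = r₁ ∧ ‖y‖ = r₂ ∧ ‖z‖ = r₃ ∧ p • x + q • y + s • z = 0 := by
  obtain ⟨k, hk⟩ : ∃ k, k = ((s * r₃) ^ 2 - (p * r₁) ^ 2 - (q * r₂) ^ 2)
    / (2 * (p * r₁) * (q * r₂)) := ⟨_, rfl⟩
  have hden : 0 < 2 * (p * r₁) * (q * r₂) := by positivity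
  rw [abs_le] at h1 h2 h3
  have hk1 : |k| ≤ 1 := by
    rw [hk, abs_div, abs_of_pos hden, div_le_one hden, abs_le]
    constructor <;> nlinarith
  have hk2 : 0 ≤ 1 - k ^ 2 := by
    have := (sq_le_one_iff_abs_le_one k).2 hk1
    linarith
  have hk3 : 2 * (p * r₁) * (q * r₂) * k = (s * r₃) ^ 2 - (p * r₁) ^ 2 - (q * r₂) ^ 2 := by
    rw [hk]; field_simp
  have hsq := Real.sq_sqrt hk2
  let x : E3 := !₂[r₁, 0, 0]
  let y : E3 := !₂[r₂ * k, r₂ * √(1 - k ^ 2), 0]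
  have hx : ‖x‖ ^ 2 = r₁ ^ 2 := by
    simp [x, EuclideanSpace.norm_sq_eq, Fin.sum_univ_three]
  have hy : ‖y‖ ^ 2 = r₂ ^ 2 := by
    simp only [y, EuclideanSpace.norm_sq_eq, Fin.sum_univ_three, Real.norm_eq_abs, sq_abs]
    simp
    rw [mul_pow, mul_pow, hsq]; ring
  have hz : ‖p • x + q • y‖ ^ 2 = (s * r₃) ^ 2 := by
    simp only [x, y, EuclideanSpace.norm_sq_eq, Fin.sum_univ_three, Real.norm_eq_abs, sq_abs]
    simp
    have : (p * r₁ + q * (r₂ * k)) ^ 2 + (q * (r₂ * √(1 - k ^ 2))) ^ 2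
      = (p * r₁) ^ 2 + 2 * (p * r₁) * (q * r₂) * k + q ^ 2 * r₂ ^ 2 * (k ^ 2 + √(1 - k ^ 2) ^ 2) := by
      ring
    rw [this, hsq, hk3]; ring
  refine ⟨x, y, -(s⁻¹ • (p • x + q • y)), ?_, ?_, ?_, ?_⟩
  · exact (sq_eq_sq₀ (norm_nonneg _) hr1.le).1 hx
  · exact (sq_eq_sq₀ (norm_nonneg _) hr2.le).1 hy
  · have := (sq_eq_sq₀ (norm_nonneg _) (by positivity)).1 hz
    rw [norm_neg, norm_smul, this, Real.norm_eq_abs, abs_of_pos (inv_pos.2 hs)]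
    field_simp
  · rw [smul_neg, smul_smul, mul_inv_cancel₀ hs.ne', one_smul]
    abel

/-! ### Polynomial remainders -/

lemma bound4 (R : ℝ → ℝ → ℝ → ℝ → ℝ)
    (hR : Continuous fun v : ℝ × ℝ × ℝ × ℝ => R v.1 v.2.1 v.2.2.1 v.2.2.2) :
    ∃ K : ℝ, 0 < K ∧ ∀ a ∈ Set.Icc (0:ℝ) 1, ∀ b ∈ Set.Icc (0:ℝ) 1, ∀ c ∈ Set.Icc (0:ℝ) 1,
      ∀ e ∈ Set.Icc (0:ℝ) 1, |R a b c e| ≤ K := by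
  have hc : IsCompact (Set.Icc (0:ℝ) 1 ×ˢ Set.Icc (0:ℝ) 1 ×ˢ Set.Icc (0:ℝ) 1 ×ˢ Set.Icc (0:ℝ) 1) :=
    isCompact_Icc.prod (isCompact_Icc.prod (isCompact_Icc.prod isCompact_Icc))
  obtain ⟨K, hK⟩ := hc.exists_bound_of_continuousOn hR.continuousOn
  refine ⟨max K 1, by positivity, fun a ha b hb c hc e he => ?_⟩
  exact (hK (a, b, c, e) ⟨ha, hb, hc, he⟩).trans (le_max_left _ _)

/-- first order coefficient of the optimal dual variables -/
noncomputable def bet (A a : ℝ) : ℝ := -(A + 12 * a) / 30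

/-- remainder of `q ^ 3` -/
noncomputable def rC (β e : ℝ) : ℝ := 3 * β ^ 2 + β ^ 3 * e
/-- remainder of a product of two cubes -/
noncomputable def rM (β γ e : ℝ) : ℝ :=
  rC β e + rC γ e + 9 * β * γ + 3 * e * (β * rC γ e + γ * rC β e) + e ^ 2 * rC β e * rC γ e
/-- remainder of `(q ^ 3) ^ 2 * r ^ 2` -/
noncomputable def rN (β a e : ℝ) : ℝ :=
  rM β β e + a ^ 2 + 12 * β * a + e * (2 * a * rM β β e + 6 * β * a ^ 2) + e ^ 2 * rM β β e * a ^ 2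
/-- remainder of the mixed product -/
noncomputable def rQ (β γ a b e : ℝ) : ℝ :=
  a ^ 2 + b ^ 2 + 2 * rM β γ e + (2 * a + 2 * b) * 3 * (β + γ)
    + e * ((2 * a + 2 * b) * rM β γ e + (a ^ 2 + b ^ 2) * 3 * (β + γ))
    + e ^ 2 * (a ^ 2 + b ^ 2) * rM β γ e

lemma rM_eq (β γ e : ℝ) :
    (1 + e * β) ^ 3 * (1 + e * γ) ^ 3 = 1 + 3 * (β + γ) * e + e ^ 2 * rM β γ e := by
  unfold rM rC; ring

lemma rN_eq (β a e : ℝ) :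
    ((1 + e * β) ^ 3) ^ 2 * (1 + e * a) ^ 2 = 1 + (6 * β + 2 * a) * e + e ^ 2 * rN β a e := by
  rw [sq ((1 + e * β) ^ 3), rM_eq]; unfold rN; ring

lemma rQ_eq (β γ a b e : ℝ) :
    ((1 + e * a) ^ 2 + (1 + e * b) ^ 2) * ((1 + e * β) ^ 3 * (1 + e * γ) ^ 3)
      = 2 + (2 * a + 2 * b + 6 * (β + γ)) * e + e ^ 2 * rQ β γ a b e := by
  rw [rM_eq]; unfold rQ; ring

lemma dist_poly : ∃ K : ℝ, 0 < K ∧ ∀ a ∈ Set.Icc (0:ℝ) 1, ∀ b ∈ Set.Icc (0:ℝ) 1,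
    ∀ c ∈ Set.Icc (0:ℝ) 1, ∀ e ∈ Set.Icc (0:ℝ) 1, ∀ A p q s : ℝ, A = a + b + c →
      p = 1 + e * bet A a → q = 1 + e * bet A b → s = 1 + e * bet A c →
      |((1 + e * a) ^ 2 + (1 + e * b) ^ 2) * (p ^ 3 * q ^ 3)
        + ((p ^ 3) ^ 2 * (1 + e * a) ^ 2 + (q ^ 3) ^ 2 * (1 + e * b) ^ 2
          - (s ^ 3) ^ 2 * (1 + e * c) ^ 2) - 3 * (p * q)| ≤ K * e ^ 2 := by
  obtain ⟨K, hK, h⟩ := bound4 (fun a b c e => rQ (bet (a + b + c) a) (bet (a + b + c) b) a b e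
    + rN (bet (a + b + c) a) a e + rN (bet (a + b + c) b) b e - rN (bet (a + b + c) c) c e
    - 3 * (bet (a + b + c) a * bet (a + b + c) b)) (by
      unfold rQ rN rM rC bet; fun_prop)
  refine ⟨K, hK, fun a ha b hb c hc e he A p q s hA hp hq hs => ?_⟩
  have := h a ha b hb c hc e he
  subst hA hp hq hs
  rw [rQ_eq, rN_eq, rN_eq, rN_eq]
  have lin : 4 * (a + b) - 2 * c + 9 * (bet (a + b + c) a + bet (a + b + c) b)
      - 6 * bet (a + b + c) c - 6 * (bet (a + b + c) a + bet (a + b + c) b)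
      + 6 * (bet (a + b + c) a + bet (a + b + c) b) = 0 := by
    unfold bet; ring
  generalize bet (a + b + c) a = β at *
  generalize bet (a + b + c) b = γ at *
  generalize bet (a + b + c) c = δ at *
  have e1 : 2 + (2 * a + 2 * b + 6 * (β + γ)) * e + e ^ 2 * rQ β γ a b e
      + (1 + (6 * β + 2 * a) * e + e ^ 2 * rN β a e + (1 + (6 * γ + 2 * b) * e + e ^ 2 * rN γ b e)
        - (1 + (6 * δ + 2 * c) * e + e ^ 2 * rN δ c e)) - 3 * ((1 + e * β) * (1 + e * γ))
      = (rQ β γ a b e + rN β a e + rN γ b e - rN δ c e - 3 * (β * γ)) * e ^ 2 := by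
    linear_combination e * lin
  rw [e1, abs_mul, abs_of_nonneg (sq_nonneg e)]
  gcongr

lemma dual_poly : ∃ K : ℝ, 0 < K ∧ ∀ a ∈ Set.Icc (0:ℝ) 1, ∀ b ∈ Set.Icc (0:ℝ) 1,
    ∀ c ∈ Set.Icc (0:ℝ) 1, ∀ e ∈ Set.Icc (0:ℝ) 1, ∀ A p q s : ℝ, A = a + b + c →
      p = 1 + e * bet A a → q = 1 + e * bet A b → s = 1 + e * bet A c →
      |dualL p q s (1 + e * a) (1 + e * b) (1 + e * c)
        - (1 - e * A / 3 + e ^ 2 * (A ^ 2 / 10 + (a ^ 2 + b ^ 2 + c ^ 2) / 30))| ≤ K * e ^ 3 := by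
  -- coefficients
  let X1 : ℝ → ℝ → ℝ → ℝ := fun β γ δ => 3 * (β + γ + δ)
  let X2 : ℝ → ℝ → ℝ → ℝ := fun β γ δ => 3 * (β ^ 2 + γ ^ 2 + δ ^ 2)
  let X3 : ℝ → ℝ → ℝ → ℝ := fun β γ δ => β ^ 3 + γ ^ 3 + δ ^ 3
  let y1 : ℝ → ℝ → ℝ := fun β a => 3 * β + 2 * a
  let y2 : ℝ → ℝ → ℝ := fun β a => 3 * β ^ 2 + 6 * β * a + a ^ 2
  let y3 : ℝ → ℝ → ℝ → ℝ := fun β a e => β ^ 3 + 6 * β ^ 2 * a + 3 * β * a ^ 2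
    + e * (2 * β ^ 3 * a + 3 * β ^ 2 * a ^ 2) + e ^ 2 * (β ^ 3 * a ^ 2)
  let R : ℝ → ℝ → ℝ → ℝ → ℝ → ℝ → ℝ → ℝ := fun β γ δ a b c e =>
    -(3 * (y3 β a e + y3 γ b e + y3 δ c e) + X1 β γ δ * (y2 β a + y2 γ b + y2 δ c)
      + X2 β γ δ * (y1 β a + y1 γ b + y1 δ c) + 3 * X3 β γ δ
      + e * (X1 β γ δ * (y3 β a e + y3 γ b e + y3 δ c e) + X2 β γ δ * (y2 β a + y2 γ b + y2 δ c)
        + X3 β γ δ * (y1 β a + y1 γ b + y1 δ c))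
      + e ^ 2 * (X2 β γ δ * (y3 β a e + y3 γ b e + y3 δ c e)
        + X3 β γ δ * (y2 β a + y2 γ b + y2 δ c))
      + e ^ 3 * (X3 β γ δ * (y3 β a e + y3 γ b e + y3 δ c e))) / 18
  obtain ⟨K, hK, h⟩ := bound4 (fun a b c e => R (bet (a + b + c) a) (bet (a + b + c) b)
    (bet (a + b + c) c) a b c e) (by
      simp only [R, X1, X2, X3, y1, y2, y3]; unfold bet; fun_prop)
  refine ⟨K, hK, fun a ha b hb c hc e he A p q s hA hp hq hs => ?_⟩
  have := h a ha b hb c hc e he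
  subst hA hp hq hs
  have l1 : bet (a + b + c) a + bet (a + b + c) b + bet (a + b + c) c = - (a + b + c) / 2 := by
    unfold bet; ring
  have l2 : (bet (a + b + c) a * bet (a + b + c) b + bet (a + b + c) a * bet (a + b + c) c
      + bet (a + b + c) b * bet (a + b + c) c) / 2
      - (3 * (y2 (bet (a + b + c) a) a + y2 (bet (a + b + c) b) b + y2 (bet (a + b + c) c) c)
        + X1 (bet (a + b + c) a) (bet (a + b + c) b) (bet (a + b + c) c)
          * (y1 (bet (a + b + c) a) a + y1 (bet (a + b + c) b) b + y1 (bet (a + b + c) c) c)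
        + 3 * X2 (bet (a + b + c) a) (bet (a + b + c) b) (bet (a + b + c) c)) / 18
      = (a + b + c) ^ 2 / 10 + (a ^ 2 + b ^ 2 + c ^ 2) / 30 := by
    simp only [X1, X2, y1, y2]; unfold bet; ring
  generalize bet (a + b + c) a = β at *
  generalize bet (a + b + c) b = γ at *
  generalize bet (a + b + c) c = δ at *
  have e1 : dualL (1 + e * β) (1 + e * γ) (1 + e * δ) (1 + e * a) (1 + e * b) (1 + e * c)
        - (1 - e * (a + b + c) / 3 + e ^ 2 * ((a + b + c) ^ 2 / 10 + (a ^ 2 + b ^ 2 + c ^ 2) / 30))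
      = R β γ δ a b c e * e ^ 3 := by
    rw [← l2]
    unfold dualL
    simp only [R, X1, X2, X3, y1, y2, y3]
    ring
  rw [e1, abs_mul, abs_of_nonneg (pow_nonneg he.1 3)]
  have := he.1
  gcongr

/-! ### Expansion of `V3` -/

lemma bet_bounds (A a e : ℝ) (hA0 : 0 ≤ A) (hA3 : A ≤ 3) (ha0 : 0 ≤ a) (ha1 : a ≤ 1)
    (he : 0 < e) (he1 : e < 1/100) :
    99/100 ≤ 1 + e * bet A a ∧ 1 + e * bet A a ≤ 1 ∧
      |(1 + e * bet A a) ^ 3 * (1 + e * a) - 1| ≤ 1/10 := by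
  have h1 : -1/2 ≤ bet A a := by unfold bet; linarith
  have h2 : bet A a ≤ 0 := by unfold bet; linarith
  have h3 : 99/100 ≤ 1 + e * bet A a := by nlinarith
  have h4 : 1 + e * bet A a ≤ 1 := by nlinarith
  refine ⟨h3, h4, ?_⟩
  generalize 1 + e * bet A a = q at *
  have h5 : (99/100) ^ 3 ≤ q ^ 3 := by gcongr
  have h6 : q ^ 3 ≤ 1 := pow_le_one₀ (by linarith) h4
  have h7 : 0 ≤ e * a := by positivity
  have h8 : e * a ≤ 1/100 := by nlinarith
  rw [abs_le]
  constructor <;> nlinarith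

lemma dist_aux (κ D p q : ℝ) (hp : 99/100 ≤ p) (hq : 99/100 ≤ q)
    (h : |D * (p ^ 3 * q ^ 3) - 3 * (p * q)| ≤ κ) : |D * (p * q) ^ 2 / 3 - 1| ≤ κ := by
  have hpq : 1 ≤ 3 * (p * q) := by nlinarith
  have e1 : D * (p ^ 3 * q ^ 3) - 3 * (p * q) = (D * (p * q) ^ 2 / 3 - 1) * (3 * (p * q)) := by
    ring
  rw [e1, abs_mul, abs_of_pos (by linarith : 0 < 3 * (p * q))] at h
  nlinarith [abs_nonneg (D * (p * q) ^ 2 / 3 - 1)]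

lemma radii_ne (e a b : ℝ) (he : 0 < e) (h : a < b) : 1 + e * a ≠ 1 + e * b := by
  have := mul_lt_mul_of_pos_left h he
  intro h'
  linarith

lemma V3_le (x y z : E3) (r₁ r₂ r₃ : ℝ) (hx : ‖x‖ = r₁) (hy : ‖y‖ = r₂) (hz : ‖z‖ = r₃) :
    V3 r₁ r₂ r₃ ≤ 1 / ‖x - y‖ + 1 / ‖x - z‖ + 1 / ‖y - z‖ := by
  refine csInf_le ⟨0, ?_⟩ ⟨x, y, z, hx, hy, hz, rfl⟩
  rintro w ⟨x', y', z', -, -, -, rfl⟩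
  positivity

set_option maxHeartbeats 800000 in
lemma V3_expansion : ∃ C δ : ℝ, 0 < C ∧ 0 < δ ∧ ∀ e : ℝ, 0 < e → e < δ →
    ∀ a b c : ℝ, 0 ≤ a → a < b → b < c → c ≤ 1 →
      |V3 (1 + e * a) (1 + e * b) (1 + e * c) - √3 * (1 - e * (a + b + c) / 3
        + e ^ 2 * ((a + b + c) ^ 2 / 10 + (a ^ 2 + b ^ 2 + c ^ 2) / 30))| ≤ C * e ^ 3 := by
  obtain ⟨K, hK, hd⟩ := dist_poly
  obtain ⟨L, hL, hl⟩ := dual_poly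
  refine ⟨√3 * (L + 6 * K ^ 2), min (1/100) (1 / (2 * K)), by positivity, by positivity, ?_⟩
  intro e he heδ a b c ha hab hbc hc
  have he1 : e < 1/100 := heδ.trans_le (min_le_left _ _)
  have he2 : e < 1 / (2 * K) := heδ.trans_le (min_le_right _ _)
  have hKe : K * e ^ 2 ≤ 1/2 := by
    rw [lt_div_iff₀ (by positivity)] at he2
    have : e ^ 2 ≤ e := by nlinarith
    nlinarith [mul_le_mul_of_nonneg_left this hK.le]
  have ia : a ∈ Set.Icc (0:ℝ) 1 := ⟨by linarith, by linarith⟩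
  have ib : b ∈ Set.Icc (0:ℝ) 1 := ⟨by linarith, by linarith⟩
  have ic : c ∈ Set.Icc (0:ℝ) 1 := ⟨by linarith, by linarith⟩
  have ie : e ∈ Set.Icc (0:ℝ) 1 := ⟨by linarith, by linarith⟩
  obtain ⟨A, hA⟩ : ∃ A, A = a + b + c := ⟨_, rfl⟩
  have hA0 : 0 ≤ A := by linarith [ia.1, ib.1, ic.1]
  have hA3 : A ≤ 3 := by linarith [ia.2, ib.2, ic.2]
  obtain ⟨p0, p1, p2⟩ := bet_bounds A a e hA0 hA3 ia.1 ia.2 he he1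
  obtain ⟨q0, q1, q2⟩ := bet_bounds A b e hA0 hA3 ib.1 ib.2 he he1
  obtain ⟨s0, s1, s2⟩ := bet_bounds A c e hA0 hA3 ic.1 ic.2 he he1
  obtain ⟨p, hp⟩ : ∃ p, p = 1 + e * bet A a := ⟨_, rfl⟩
  obtain ⟨q, hq⟩ : ∃ q, q = 1 + e * bet A b := ⟨_, rfl⟩
  obtain ⟨s, hs⟩ : ∃ s, s = 1 + e * bet A c := ⟨_, rfl⟩
  have hl' := hl a ia b ib c ic e ie A p q s hA hp hq hs
  have d1 := hd a ia b ib c ic e ie A p q s hA hp hq hs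
  have d2 := hd a ia c ic b ib e ie A p s q (by linarith) hp hs hq
  have d3 := hd b ib c ic a ia e ie A q s p (by linarith) hq hs hp
  rw [← hp] at p0 p1 p2
  rw [← hq] at q0 q1 q2
  rw [← hs] at s0 s1 s2
  rw [← hA]
  have pp : 0 < p := by linarith
  have pq : 0 < q := by linarith
  have ps : 0 < s := by linarith
  have r1 : 0 < 1 + e * a := by have := ia.1; positivity
  have r2 : 0 < 1 + e * b := by have := ib.1; positivity
  have r3 : 0 < 1 + e * c := by have := ic.1; positivity
  have r12 : 1 + e * a ≠ 1 + e * b := radii_ne e a b he hab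
  have r13 : 1 + e * a ≠ 1 + e * c := radii_ne e a c he (hab.trans hbc)
  have r23 : 1 + e * b ≠ 1 + e * c := radii_ne e b c he hbc
  obtain ⟨x, y, z, hx, hy, hz, h0⟩ := exists_config (1 + e * a) (1 + e * b) (1 + e * c)
    (p ^ 3) (q ^ 3) (s ^ 3) r1 r2 r3 (by positivity) (by positivity) (by positivity) p2 q2 s2
  have hne : ∀ u v : E3, ‖u‖ ≠ ‖v‖ → u ≠ v := fun u v h h' => h (by rw [h'])
  -- lower bound
  have low : √3 * dualL p q s (1 + e * a) (1 + e * b) (1 + e * c)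
      ≤ V3 (1 + e * a) (1 + e * b) (1 + e * c) := by
    apply le_csInf
    · exact ⟨_, x, y, z, hx, hy, hz, rfl⟩
    · rintro w ⟨x', y', z', hx', hy', hz', rfl⟩
      rw [← hx', ← hy', ← hz']
      rw [← hx', ← hy'] at r12
      rw [← hx', ← hz'] at r13
      rw [← hy', ← hz'] at r23
      exact energy_lower x' y' z' (hne _ _ r12) (hne _ _ r13) (hne _ _ r23) p q s pp pq ps
  have up : V3 (1 + e * a) (1 + e * b) (1 + e * c)
      ≤ √3 * dualL p q s (1 + e * a) (1 + e * b) (1 + e * c) + 6 * √3 * (K * e ^ 2) ^ 2 := by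
    refine (V3_le x y z _ _ _ hx hy hz).trans ?_
    · have k1 := dist_of_zero x y z _ _ _ h0
      have k2 := dist_of_zero x z y (p ^ 3) (s ^ 3) (q ^ 3) (by rw [← h0]; abel)
      have k3 := dist_of_zero y z x (q ^ 3) (s ^ 3) (p ^ 3) (by rw [← h0]; abel)
      rw [hx, hy, hz] at k1 k2 k3
      rw [← k1] at d1
      rw [← k2] at d2
      rw [← k3] at d3
      have := energy_upper x y z (hne _ _ (by rwa [hx, hy])) (hne _ _ (by rwa [hx, hz]))
        (hne _ _ (by rwa [hy, hz])) p q s pp pq ps p1 q1 s1 h0 (K * e ^ 2) hKe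
        (dist_aux _ _ p q p0 q0 d1) (dist_aux _ _ p s p0 s0 d2) (dist_aux _ _ q s q0 s0 d3)
      rwa [hx, hy, hz] at this
  have h34 : e ^ 4 ≤ e ^ 3 := pow_le_pow_of_le_one ie.1 ie.2 (by norm_num)
  have hs3 : 0 ≤ √3 := Real.sqrt_nonneg 3
  have hfin : 6 * √3 * (K * e ^ 2) ^ 2 ≤ √3 * (6 * K ^ 2) * e ^ 3 := by
    calc 6 * √3 * (K * e ^ 2) ^ 2 = √3 * (6 * K ^ 2) * e ^ 4 := by ring
      _ ≤ _ := by gcongr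
  rw [abs_le] at hl' ⊢
  have m1 := mul_le_mul_of_nonneg_left hl'.1 hs3
  have m2 := mul_le_mul_of_nonneg_left hl'.2 hs3
  have : 0 ≤ √3 * (6 * K ^ 2) * e ^ 3 := by positivity
  rw [mul_sub] at m1 m2
  constructor <;> linarith

/-! ### Measurability of `V3` -/

/-- extended-real version of `V3` -/
noncomputable def W3 (r : ℝ × ℝ × ℝ) : ENNReal :=
  ⨅ u : Metric.sphere (0 : E3) 1 × Metric.sphere (0 : E3) 1 × Metric.sphere (0 : E3) 1,
    (‖r.1 • (u.1 : E3) - r.2.1 • (u.2.1 : E3)‖ₑ⁻¹ + ‖r.1 • (u.1 : E3) - r.2.2 • (u.2.2 : E3)‖ₑ⁻¹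
      + ‖r.2.1 • (u.2.1 : E3) - r.2.2 • (u.2.2 : E3)‖ₑ⁻¹)

lemma W3_meas : Measurable W3 := by
  apply UpperSemicontinuous.measurable
  apply upperSemicontinuous_iInf
  intro u
  apply Continuous.upperSemicontinuous
  fun_prop

lemma W3_eq (a b c : ℝ) (ha : 0 < a) (hb : 0 < b) (hc : 0 < c) (hab : a ≠ b) (hac : a ≠ c)
    (hbc : b ≠ c) : (W3 (a, b, c)).toReal = V3 a b c := by
  have hne : ∀ (r t : ℝ) (u v : Metric.sphere (0 : E3) 1), 0 < r → 0 < t → r ≠ t →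
      r • (u : E3) - t • (v : E3) ≠ 0 := by
    intro r t u v hr ht hrt h
    have := congrArg norm (sub_eq_zero.1 h)
    simp [norm_smul, abs_of_pos hr, abs_of_pos ht] at this
    exact hrt this
  have hfin : ∀ (r t : ℝ) (u v : Metric.sphere (0 : E3) 1), 0 < r → 0 < t → r ≠ t →
      ‖r • (u : E3) - t • (v : E3)‖ₑ⁻¹ ≠ ⊤ := by
    intro r t u v hr ht hrt
    rw [ENNReal.inv_ne_top]
    exact enorm_ne_zero.2 (hne r t u v hr ht hrt)
  unfold W3
  rw [ENNReal.toReal_iInf]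
  · unfold V3 iInf
    congr 1
    ext w
    constructor
    · rintro ⟨⟨u, v, t⟩, rfl⟩
      refine ⟨a • (u : E3), b • (v : E3), c • (t : E3), ?_, ?_, ?_, ?_⟩
      · simp [norm_smul, abs_of_pos ha]
      · simp [norm_smul, abs_of_pos hb]
      · simp [norm_smul, abs_of_pos hc]
      · simp only
        rw [ENNReal.toReal_add (ENNReal.add_ne_top.2 ⟨hfin _ _ _ _ ha hb hab, hfin _ _ _ _ ha hc hac⟩)
          (hfin _ _ _ _ hb hc hbc),
          ENNReal.toReal_add (hfin _ _ _ _ ha hb hab) (hfin _ _ _ _ ha hc hac)]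
        simp
    · rintro ⟨x, y, z, hx, hy, hz, rfl⟩
      have hsp : ∀ (r : ℝ) (x : E3), 0 < r → ‖x‖ = r → ∃ u : Metric.sphere (0 : E3) 1,
          x = r • (u : E3) := by
        intro r x hr hx
        refine ⟨⟨r⁻¹ • x, ?_⟩, ?_⟩
        · simp [norm_smul, hx, abs_of_pos hr, hr.ne']
        · simp [smul_smul, hr.ne']
      obtain ⟨u, rfl⟩ := hsp a x ha hx
      obtain ⟨v, rfl⟩ := hsp b y hb hy
      obtain ⟨t, rfl⟩ := hsp c z hc hz
      refine ⟨(u, v, t), ?_⟩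
      simp only
      rw [ENNReal.toReal_add (ENNReal.add_ne_top.2 ⟨hfin _ _ _ _ ha hb hab, hfin _ _ _ _ ha hc hac⟩)
          (hfin _ _ _ _ hb hc hbc),
          ENNReal.toReal_add (hfin _ _ _ _ ha hb hab) (hfin _ _ _ _ ha hc hac)]
      simp
  · rintro ⟨u, v, t⟩
    exact ENNReal.add_ne_top.2 ⟨ENNReal.add_ne_top.2 ⟨hfin _ _ _ _ ha hb hab,
      hfin _ _ _ _ ha hc hac⟩, hfin _ _ _ _ hb hc hbc⟩

/-- almost everywhere on the first third, the three radii are ordered -/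
lemma frc_order : ∀ᵐ x : ℝ, x ∈ Set.uIoc (0:ℝ) (1/3) →
    0 ≤ x ∧ x < shiftMap 3 x ∧ shiftMap 3 x < shiftMap 3 (shiftMap 3 x)
      ∧ shiftMap 3 (shiftMap 3 x) ≤ 1 := by
  have h1 : ∀ᵐ y : ℝ, y ≠ 1/6 := by
    rw [ae_iff]; simp
  have h2 : ∀ᵐ y : ℝ, y ≠ 1/3 := by
    rw [ae_iff]; simp
  filter_upwards [h1, h2] with x x1 x2 hx
  rw [Set.uIoc_of_le (by norm_num)] at hx
  have hx1 : x < 1/3 := lt_of_le_of_ne hx.2 x2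
  have e : x = (((0 : ℕ) : ℝ) + 3 * x) / 3 := by push_cast; ring
  have y0 : 0 ≤ 3 * x := by linarith [hx.1]
  have y1 : 3 * x < 1 := by linarith
  have y2 : 3 * x ≠ 1/2 := fun h => x1 (by linarith)
  have s1 := shift_rec 0 (by norm_num) (3 * x) y0 y1
  have s2 := shift_shift_rec 0 (by norm_num) (3 * x) y0 y1 y2
  rw [← e] at s1 s2
  have t1 := shift_lt_one _ y0 y1 y2
  have t0 := shift_nonneg (3 * x)
  have t2 := shift_nonneg (shiftMap 3 (3 * x))
  norm_num at s1 s2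
  refine ⟨hx.1.le, ?_, ?_, shift_le_one _⟩
  · rw [s1]; linarith
  · rw [s2, s1]; linarith

/-- **Small-`ε` expansion of the fractal interaction energy:**
`F(ε) = √3·(1 − ε/2 + (31/120)ε²) + O(ε³)` as `ε → 0⁺`. -/
theorem frc_energy_expansion :
    ∃ C δ : ℝ, 0 < C ∧ 0 < δ ∧ ∀ ε : ℝ, 0 < ε → ε < δ →
      |Ffrc ε - Real.sqrt 3 * (1 - ε / 2 + (31/120) * ε ^ 2)| ≤ C * ε ^ 3 := by
  obtain ⟨C, δ, hC, hδ, h⟩ := V3_expansion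
  refine ⟨C, δ, hC, hδ, fun ε hε hεδ => ?_⟩
  have h := h ε hε hεδ
  obtain ⟨Q, hQ⟩ : ∃ Q : ℝ → ℝ, Q = fun x => √3 * (1 - ε * sA x / 3
    + ε ^ 2 * (sA x ^ 2 / 10 + sP x / 30)) := ⟨_, rfl⟩
  obtain ⟨f, hf⟩ : ∃ f : ℝ → ℝ, f = fun x => V3 (1 + ε * x) (1 + ε * shiftMap 3 x)
    (1 + ε * shiftMap 3 (shiftMap 3 x)) := ⟨_, rfl⟩
  have i0 : IntervalIntegrable (fun _ : ℝ => (1:ℝ)) volume 0 (1/3) := by simp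
  have i1 : IntervalIntegrable (fun x => ε * sA x / 3) volume 0 (1/3) :=
    ((sA_ii 0 (1/3)).const_mul ε).div_const 3
  have i2 := (sA2_ii 0 (1/3)).div_const 10
  have i3 := (sP_ii 0 (1/3)).div_const 30
  have iQ : IntervalIntegrable Q volume 0 (1/3) := by
    rw [hQ]
    exact ((i0.sub i1).add ((i2.add i3).const_mul _)).const_mul _
  have hQint : ∫ x in (0:ℝ)..(1/3), Q x = √3 * (1 - ε / 2 + (31/120) * ε ^ 2) / 3 := by
    rw [hQ, intervalIntegral.integral_const_mul,
      intervalIntegral.integral_add (i0.sub i1) ((i2.add i3).const_mul _),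
      intervalIntegral.integral_sub i0 i1, intervalIntegral.integral_const_mul,
      intervalIntegral.integral_add i2 i3, intervalIntegral.integral_div,
      intervalIntegral.integral_div, intervalIntegral.integral_div,
      intervalIntegral.integral_const_mul, third_sA, third_sA2, third_sP]
    simp
    ring
  have hbd : ∀ᵐ x : ℝ, x ∈ Set.uIoc (0:ℝ) (1/3) → ‖f x - Q x‖ ≤ C * ε ^ 3 := by
    filter_upwards [frc_order] with x hx hx'
    obtain ⟨a1, a2, a3, a4⟩ := hx hx'
    rw [hf, hQ]
    exact h x _ _ a1 a2 a3 a4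
  have hmeas : AEStronglyMeasurable f (volume.restrict (Set.uIoc (0:ℝ) (1/3))) := by
    have hm : Measurable fun x : ℝ => (W3 (1 + ε * x, 1 + ε * shiftMap 3 x,
        1 + ε * shiftMap 3 (shiftMap 3 x))).toReal := by
      apply ENNReal.measurable_toReal.comp
      apply W3_meas.comp
      have m1 := shift_measurable
      have m2 : Measurable fun x => shiftMap 3 (shiftMap 3 x) := m1.comp m1
      exact ((measurable_id.const_mul ε).const_add 1).prodMk
        (((m1.const_mul ε).const_add 1).prodMk ((m2.const_mul ε).const_add 1))
    refine hm.aestronglyMeasurable.congr ?_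
    refine (ae_restrict_iff' measurableSet_uIoc).2 ?_
    filter_upwards [frc_order] with x hx hx'
    obtain ⟨a1, a2, a3, a4⟩ := hx hx'
    have a5 : 0 ≤ shiftMap 3 x := shift_nonneg _
    have a6 : 0 ≤ shiftMap 3 (shiftMap 3 x) := shift_nonneg _
    rw [hf]
    refine W3_eq _ _ _ (by positivity) (by positivity) (by positivity) ?_ ?_ ?_ <;> nlinarith
  have iD : IntervalIntegrable (fun x => f x - Q x) volume 0 (1/3) := by
    rw [intervalIntegrable_iff]
    have hc : IntegrableOn (fun _ : ℝ => C * ε ^ 3) (Set.uIoc (0:ℝ) (1/3)) volume :=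
      integrableOn_const (by simp)
    refine Integrable.mono' hc
      (hmeas.sub (intervalIntegrable_iff.1 iQ).aestronglyMeasurable) ?_
    exact (ae_restrict_iff' measurableSet_uIoc).2 hbd
  have iF : IntervalIntegrable f volume 0 (1/3) := by
    have := iD.add iQ
    simpa using this
  have hn := intervalIntegral.norm_integral_le_of_norm_le_const_ae hbd
  rw [intervalIntegral.integral_sub iF iQ, hQint, Real.norm_eq_abs] at hn
  have hF : Ffrc ε = 3 * ∫ x in (0:ℝ)..(1/3), f x := by rw [hf]; rfl
  rw [hF]
  norm_num at hn
  rw [abs_le] at hn ⊢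
  constructor <;> linarith [hn.1, hn.2]
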